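/- Let f^Ow be the multilinear extension of a capacity μ on N. For every subset S ⊆ N, the ANOVA component f_S of f^Ow satisfies f_S(z) = (−1)^{|S|} Π_{i∈S} (2 z_i − 1) · μ̂(S) for all z ∈ [0,1]^S, where μ̂ is the Fourier transform of μ. -/

import Mathlib

open MeasureTheory Finset

/-- The uniform probability measure on the unit cube `[0,1]^n`. -/
noncomputable def unifCube (n : ℕ) : Measure (Fin n → ℝ) :=
  Measure.pi fun _ => volume.restrict (Set.Icc 0 1)

/-- The Möbius transform of a set function. -/
noncomputable def mobius {n : ℕ} (ξ : Finset (Fin n) → ℝ) (S : Finset (Fin n)) : ℝ :=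
  ∑ T ∈ S.powerset, (-1 : ℝ) ^ (S \ T).card * ξ T

/-- The Fourier transform of a set function. -/
noncomputable def fourierT {n : ℕ} (ξ : Finset (Fin n) → ℝ) (S : Finset (Fin n)) : ℝ :=
  (1 / 2 ^ n : ℝ) * ∑ T : Finset (Fin n), (-1 : ℝ) ^ (S ∩ T).card * ξ T

/-- The Banzhaf interaction transform of a set function. -/
noncomputable def banzhaf {n : ℕ} (ξ : Finset (Fin n) → ℝ) (S : Finset (Fin n)) : ℝ :=
  (1 / 2 : ℝ) ^ (n - S.card) * ∑ K : Finset (Fin n), (-1 : ℝ) ^ (S \ K).card * ξ K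

/-- The multilinear (Owen) extension associated with coefficients `m`. -/
noncomputable def fOw {n : ℕ} (m : Finset (Fin n) → ℝ) (x : Fin n → ℝ) : ℝ :=
  ∑ T : Finset (Fin n), m T * ∏ i ∈ T, x i

/-- A capacity: vanishes on the empty set and is monotone. -/
def Capacity {n : ℕ} (μ : Finset (Fin n) → ℝ) : Prop :=
  μ ∅ = 0 ∧ ∀ S T : Finset (Fin n), S ⊆ T → μ S ≤ μ T

/-- The ANOVA component of `f` associated with the subset `S`. -/
noncomputable def anova {n : ℕ} (f : (Fin n → ℝ) → ℝ) (S : Finset (Fin n))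
    (z : Fin n → ℝ) : ℝ :=
  ∑ T ∈ S.powerset, (-1 : ℝ) ^ (S \ T).card *
    ∫ y, f (fun i => if i ∈ T then z i else y i) ∂unifCube n

/-- The Choquet integral (Lovász extension) of a 2-additive capacity with
Möbius transform `m`. -/
noncomputable def fLo {n : ℕ} (m : Finset (Fin n) → ℝ) (z : Fin n → ℝ) : ℝ :=
  ∑ i, m {i} * z i +
    ∑ i, ∑ j ∈ Finset.univ.filter (fun j => i < j), m {i, j} * min (z i) (z j)

/-- The multilinear extension of a Möbius transform, written as the interpolation polynomial of
the set function at the vertices of the cube. -/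
theorem fOw_mobius {n : ℕ} (ξ : Finset (Fin n) → ℝ) (x : Fin n → ℝ) :
    fOw (mobius ξ) x = ∑ K : Finset (Fin n), ξ K * ∏ i, (if i ∈ K then x i else 1 - x i) := by
  have vertex_expand (K : Finset (Fin n)) : ∏ i, (if i ∈ K then x i else 1 - x i) =
      ∑ T : Finset (Fin n), if K ⊆ T then (-1 : ℝ) ^ (T \ K).card * ∏ i ∈ T, x i else 0 := by
    have split (i : Fin n) : (if i ∈ K then x i else 1 - x i) =
        (if i ∈ K then 1 else -1) * x i + (if i ∈ K then 0 else 1) := by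
      split_ifs <;> ring
    simp_rw [split]
    rw [Finset.prod_add, Finset.powerset_univ]
    refine Finset.sum_congr rfl fun T _ => ?_
    split_ifs with h
    · rw [Finset.prod_mul_distrib, Finset.prod_eq_one (s := univ \ T), mul_one]
      · congr 1
        rw [Finset.prod_ite, Finset.prod_const_one, one_mul, Finset.prod_const,
          Finset.filter_notMem_eq_sdiff]
      · intro i hi
        rw [if_neg fun hK => (Finset.mem_sdiff.mp hi).2 (h hK)]
    · obtain ⟨i, hK, hT⟩ := Finset.not_subset.mp h
      exact mul_eq_zero_of_right _ (Finset.prod_eq_zero (show i ∈ univ \ T by simp [hT]) (if_pos hK))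
  simp_rw [vertex_expand, Finset.mul_sum]
  rw [Finset.sum_comm, fOw]
  refine Finset.sum_congr rfl fun T _ => ?_
  simp_rw [mul_ite, mul_zero]
  rw [mobius, Finset.sum_mul, ← Finset.sum_filter]
  refine Finset.sum_congr (by ext; simp) fun K _ => by ring

theorem integral_fOw_mobius_ite {n : ℕ} (ξ : Finset (Fin n) → ℝ) (T : Finset (Fin n))
    (z : Fin n → ℝ) :
    ∫ y, fOw (mobius ξ) (fun i => if i ∈ T then z i else y i) ∂unifCube n =
      ∑ K : Finset (Fin n), ξ K *
        ∏ i, (if i ∈ T then (if i ∈ K then z i else 1 - z i) else 1 / 2) := by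
  let g (K : Finset (Fin n)) (i : Fin n) (t : ℝ) : ℝ :=
    if i ∈ T then (if i ∈ K then z i else 1 - z i) else (if i ∈ K then t else 1 - t)
  have integrand (y : Fin n → ℝ) : fOw (mobius ξ) (fun i => if i ∈ T then z i else y i) =
      ∑ K : Finset (Fin n), ξ K * ∏ i, g K i (y i) := by
    rw [fOw_mobius]
    refine Finset.sum_congr rfl fun K _ => congrArg _ (Finset.prod_congr rfl fun i _ => ?_)
    simp only [g]
    split_ifs <;> rfl
  have g_continuous (K : Finset (Fin n)) (i : Fin n) : Continuous (g K i) := by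
    simp only [g]
    split_ifs <;> fun_prop
  have g_integrable (K : Finset (Fin n)) (i : Fin n) :
      Integrable (g K i) (volume.restrict (Set.Icc 0 1)) :=
    (g_continuous K i).continuousOn.integrableOn_Icc
  simp_rw [integrand, unifCube]
  rw [integral_finsetSum _ fun K _ => (Integrable.fintype_prod (g_integrable K)).const_mul _]
  refine Finset.sum_congr rfl fun K _ => ?_
  rw [integral_const_mul, integral_fintype_prod_eq_prod]
  refine congrArg _ (Finset.prod_congr rfl fun i _ => ?_)
  rw [integral_Icc_eq_integral_Ioc, ← intervalIntegral.integral_of_le zero_le_one]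
  simp only [g]
  split_ifs
  · simp
  · simp
  · simp [integral_id]
  · rw [intervalIntegral.integral_sub (by simp) (by simp)]
    norm_num [integral_id]

/-- Möbius inversion over `S` turns a product of switched factors into a product of differences. -/
theorem sum_powerset_neg_one_pow_mul_prod_ite {n : ℕ} (S : Finset (Fin n)) (a b : Fin n → ℝ) :
    ∑ T ∈ S.powerset, (-1 : ℝ) ^ (S \ T).card * ∏ i, (if i ∈ T then a i else b i) =
      (∏ i ∈ S, (a i - b i)) * ∏ i ∈ Sᶜ, b i := by
  simp_rw [sub_eq_add_neg]
  rw [Finset.prod_add, Finset.sum_mul]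
  refine Finset.sum_congr rfl fun T hT => ?_
  have hTS := Finset.mem_powerset.mp hT
  rw [← Finset.prod_mul_prod_compl S, ← Finset.prod_sdiff hTS, Finset.prod_neg,
    Finset.prod_congr rfl fun i hi => if_neg (Finset.mem_sdiff.mp hi).2,
    Finset.prod_congr (s₁ := T) rfl fun i hi => if_pos hi,
    Finset.prod_congr (s₁ := Sᶜ) rfl fun i hi =>
      if_neg fun hiT => Finset.mem_compl.mp hi (hTS hiT)]
  ring

theorem prod_vertex_sub_half {n : ℕ} (S K : Finset (Fin n)) (z : Fin n → ℝ) :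
    ∏ i ∈ S, ((if i ∈ K then z i else 1 - z i) - 1 / 2) =
      (1 / 2) ^ S.card * ((-1) ^ S.card * (-1) ^ (S ∩ K).card) * ∏ i ∈ S, (2 * z i - 1) := by
  rw [← Finset.filter_mem_eq_inter, ← Finset.prod_const (-1 : ℝ) (s := S.filter (· ∈ K)),
    Finset.prod_filter, ← Finset.prod_const, ← Finset.prod_const, ← Finset.prod_mul_distrib,
    ← Finset.prod_mul_distrib, ← Finset.prod_mul_distrib]
  refine Finset.prod_congr rfl fun i _ => ?_
  split_ifs <;> ring

/-- The ANOVA component of the multilinear extension of a capacity: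
`f_S(z) = (-1)^{|S|} ∏_{i ∈ S} (2 z_i - 1) ⋅ μ̂(S)`. -/
theorem anova_fOw_eq (n : ℕ) (μ : Finset (Fin n) → ℝ) (hμ : Capacity μ)
    (S : Finset (Fin n)) (z : Fin n → ℝ) (hz : ∀ i ∈ S, z i ∈ Set.Icc (0 : ℝ) 1) :
    anova (fOw (mobius μ)) S z =
      (-1 : ℝ) ^ S.card * (∏ i ∈ S, (2 * z i - 1)) * fourierT μ S := by
  simp_rw [anova, integral_fOw_mobius_ite, Finset.mul_sum]
  rw [Finset.sum_comm, fourierT, Finset.mul_sum, Finset.mul_sum]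
  refine Finset.sum_congr rfl fun K _ => ?_
  simp_rw [mul_left_comm _ (μ K)]
  rw [← Finset.mul_sum, sum_powerset_neg_one_pow_mul_prod_ite, prod_vertex_sub_half,
    Finset.prod_const]
  have half_pow : (1 / 2 ^ n : ℝ) = (1 / 2) ^ S.card * (1 / 2) ^ Sᶜ.card := by
    rw [← pow_add, Finset.card_add_card_compl, Fintype.card_fin, one_div_pow]
  rw [half_pow]
  ring
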